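/- arXiv:1808.01663 — 3 statements merged into one kernel-verified Lean document; each statement's English description precedes it below -/
import Mathlib

section
/- Let (X,d) be a premetric space and F, G, H Cauchy families on X, and let p, q be nonnegative rationals. If d(F,G) ≤ p and d(G,H) ≤ q, then d(F,H) ≤ p+q. -/
/-- A premetric on a set `X` (Richman): a relation `le x y q`, read "d(x,y) ≤ q",
between pairs of points and nonnegative rationals. -/
structure Premetric (X : Type*) where
  le : X → X → ℚ≥0 → Prop
  refl_iff : ∀ x y : X, le x y 0 ↔ x = y
  symm : ∀ (x y : X) (q : ℚ≥0), le x y q → le y x q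
  triangle : ∀ (x y z : X) (p q : ℚ≥0), le x z p → le z y q → le x y (p + q)
  upper : ∀ (x y : X) (p : ℚ≥0), le x y p ↔ ∀ q : ℚ≥0, p < q → le x y q

/-- A pseudo-premetric on a set `X`: conditions (2),(3),(4) of a premetric
together with `d(x,x) ≤ 0` for all `x`. -/
structure PseudoPremetric (X : Type*) where
  le : X → X → ℚ≥0 → Prop
  refl : ∀ x : X, le x x 0
  symm : ∀ (x y : X) (q : ℚ≥0), le x y q → le y x q
  triangle : ∀ (x y z : X) (p q : ℚ≥0), le x z p → le z y q → le x y (p + q)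
  upper : ∀ (x y : X) (p : ℚ≥0), le x y p ↔ ∀ q : ℚ≥0, p < q → le x y q

namespace Premetric

variable {X : Type*} (d : Premetric X)

theorem refl (x : X) : d.le x x 0 := (d.refl_iff x x).2 rfl

theorem mono {x y : X} {p q : ℚ≥0} (h : d.le x y p) (hpq : p ≤ q) : d.le x y q := by
  rcases eq_or_lt_of_le hpq with rfl | hlt
  · exact h
  · exact (d.upper x y p).1 h q hlt

/-- `diam A ≤ q` : any two points of `A` are at distance at most `q`. -/
def diamLE (A : Set X) (q : ℚ≥0) : Prop := ∀ x ∈ A, ∀ y ∈ A, d.le x y q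

theorem diamLE_mono {A : Set X} {p q : ℚ≥0} (h : d.diamLE A p) (hpq : p ≤ q) :
    d.diamLE A q := fun x hx y hy => d.mono (h x hx y hy) hpq

/-- A Cauchy family on a premetric space: a collection of subsets, any two of which
meet, containing sets of arbitrarily small diameter. -/
def IsCauchyFamily (F : Set (Set X)) : Prop :=
  (∀ S ∈ F, ∀ T ∈ F, (S ∩ T).Nonempty) ∧
  (∀ ε : ℚ≥0, 0 < ε → ∃ S ∈ F, d.diamLE S ε)

/-- The pseudo-premetric `d(F,F') ≤ q` between families of subsets of `X`. -/
def famLE (F F' : Set (Set X)) (q : ℚ≥0) : Prop :=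
  ∀ ε : ℚ≥0, 0 < ε → ∃ S ∈ F, ∃ T ∈ F',
    d.diamLE S ε ∧ d.diamLE T ε ∧ d.diamLE (S ∪ T) (q + ε)

theorem isCauchyFamily_singleton (x : X) :
    d.IsCauchyFamily {({x} : Set X)} := by
  constructor
  · intro S hS T hT
    rw [Set.mem_singleton_iff] at hS hT
    subst hS; subst hT
    exact ⟨x, by simp⟩
  · intro ε hε
    refine ⟨{x}, rfl, ?_⟩
    intro a ha b hb
    rw [Set.mem_singleton_iff] at ha hb
    rw [ha, hb]
    exact d.mono (d.refl x) zero_le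

theorem famLE_self {F : Set (Set X)} (hF : d.IsCauchyFamily F) (q : ℚ≥0) :
    d.famLE F F q := by
  intro ε hε
  obtain ⟨S, hS, hdiam⟩ := hF.2 ε hε
  refine ⟨S, hS, S, hS, hdiam, hdiam, ?_⟩
  rw [Set.union_self]
  exact d.diamLE_mono hdiam (le_add_of_nonneg_left zero_le)

theorem famLE_symm {F G : Set (Set X)} {q : ℚ≥0} (h : d.famLE F G q) :
    d.famLE G F q := by
  intro ε hε
  obtain ⟨S, hS, T, hT, h1, h2, h3⟩ := h ε hε
  exact ⟨T, hT, S, hS, h2, h1, by rwa [Set.union_comm]⟩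

theorem famLE_mono {F G : Set (Set X)} {p q : ℚ≥0} (h : d.famLE F G p) (hpq : p ≤ q) :
    d.famLE F G q := by
  intro ε hε
  obtain ⟨S, hS, T, hT, h1, h2, h3⟩ := h ε hε
  exact ⟨S, hS, T, hT, h1, h2, d.diamLE_mono h3 (add_le_add hpq le_rfl)⟩

theorem famLE_triangle {F G H : Set (Set X)} {p q : ℚ≥0} (hG : d.IsCauchyFamily G)
    (h1 : d.famLE F G p) (h2 : d.famLE G H q) : d.famLE F H (p + q) := by
  intro ε hε
  have h2pos : (0:ℚ≥0) < 2 := by norm_num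
  have hε2 : 0 < ε / 2 := div_pos hε h2pos
  have hhalves : ε / 2 + ε / 2 = ε := by
    rw [← add_div, ← two_mul, mul_div_cancel_left₀]
    norm_num
  have hhalf : ε / 2 ≤ ε := by
    calc ε / 2 ≤ ε / 2 + ε / 2 := le_add_of_nonneg_right zero_le
    _ = ε := hhalves
  obtain ⟨S, hS, T, hT, hdS, hdT, hST⟩ := h1 (ε/2) hε2
  obtain ⟨T', hT', U, hU, hdT', hdU, hTU⟩ := h2 (ε/2) hε2
  obtain ⟨t, htT, htT'⟩ := hG.1 T hT T' hT'
  have key : ∀ x ∈ S, ∀ y ∈ U, d.le x y (p + q + ε) := by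
    intro x hx y hy
    have hxt : d.le x t (p + ε/2) := hST x (Or.inl hx) t (Or.inr htT)
    have hty : d.le t y (q + ε/2) := hTU t (Or.inl htT') y (Or.inr hy)
    have htr := d.triangle x y t _ _ hxt hty
    have heq : (p + ε/2) + (q + ε/2) = p + q + ε := by
      rw [add_add_add_comm, hhalves]
    rwa [heq] at htr
  refine ⟨S, hS, U, hU, d.diamLE_mono hdS hhalf, d.diamLE_mono hdU hhalf, ?_⟩
  rintro x (hx | hx) y (hy | hy)
  · exact d.mono (hdS x hx y hy) (hhalf.trans (le_add_of_nonneg_left zero_le))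
  · exact key x hx y hy
  · exact d.symm _ _ _ (key y hy x hx)
  · exact d.mono (hdU x hx y hy) (hhalf.trans (le_add_of_nonneg_left zero_le))

theorem famLE_upper {F G : Set (Set X)} (p : ℚ≥0) :
    d.famLE F G p ↔ ∀ q : ℚ≥0, p < q → d.famLE F G q := by
  constructor
  · intro h q hpq
    exact d.famLE_mono h hpq.le
  · intro h ε hε
    have h2pos : (0:ℚ≥0) < 2 := by norm_num
    have hε2 : 0 < ε / 2 := div_pos hε h2pos
    have hhalves : ε / 2 + ε / 2 = ε := by
      rw [← add_div, ← two_mul, mul_div_cancel_left₀]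
      norm_num
    have hhalf : ε / 2 ≤ ε := by
      calc ε / 2 ≤ ε / 2 + ε / 2 := le_add_of_nonneg_right zero_le
      _ = ε := hhalves
    obtain ⟨S, hS, T, hT, h1, h2, h3⟩ :=
      h (p + ε/2) (lt_add_of_pos_right p hε2) (ε/2) hε2
    refine ⟨S, hS, T, hT, d.diamLE_mono h1 hhalf, d.diamLE_mono h2 hhalf, ?_⟩
    have heq : p + ε/2 + ε/2 = p + ε := by rw [add_assoc, hhalves]
    rwa [heq] at h3

theorem famLE_congr {F F' G G' : Set (Set X)} {q : ℚ≥0}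
    (hF : d.IsCauchyFamily F) (hG : d.IsCauchyFamily G)
    (hFF' : d.famLE F F' 0) (hGG' : d.famLE G G' 0)
    (h : d.famLE F G q) : d.famLE F' G' q := by
  have h1 : d.famLE F' G q := by
    have := d.famLE_triangle hF (d.famLE_symm hFF') h
    simpa using this
  have := d.famLE_triangle hG h1 hGG'
  simpa using this

/-- The type of Cauchy families on `X`. -/
def CauchyFam := {F : Set (Set X) // d.IsCauchyFamily F}

instance famSetoid : Setoid d.CauchyFam where
  r F G := d.famLE F.1 G.1 0
  iseqv := by
    refine ⟨fun F => d.famLE_self F.2 0, fun h => d.famLE_symm h, fun {F G H} h1 h2 => ?_⟩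
    have := d.famLE_triangle G.2 h1 h2
    simpa using this

/-- The completion `X̂`: the quotient of the Cauchy families by `d(F,F') ≤ 0`. -/
def Hat := Quotient d.famSetoid

/-- The premetric relation `d̂` on the quotient. -/
def hatLE (α β : d.Hat) (q : ℚ≥0) : Prop :=
  Quotient.liftOn₂ α β (fun F G => d.famLE F.1 G.1 q)
    (fun F G F' G' hF hG => propext
      ⟨fun h => d.famLE_congr F.2 G.2 hF hG h,
       fun h => d.famLE_congr F'.2 G'.2 (d.famLE_symm hF) (d.famLE_symm hG) h⟩)

/-- The premetric space `(X̂, d̂)`. -/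
def hatPremetric : Premetric d.Hat where
  le := d.hatLE
  refl_iff := fun α β => Quotient.inductionOn₂ α β fun F G =>
    ⟨fun h => Quotient.sound h, fun h => Quotient.exact h⟩
  symm := fun α β q => Quotient.inductionOn₂ α β fun F G h => d.famLE_symm h
  triangle := fun α β γ p q => Quotient.inductionOn₃ α β γ
    fun F G H h1 h2 => d.famLE_triangle H.2 h1 h2
  upper := fun α β p => Quotient.inductionOn₂ α β fun F G => d.famLE_upper p

/-- The natural map `i : X → X̂`, `x ↦ x*`, the class of the Cauchy family `{{x}}`. -/
def natMap (x : X) : d.Hat :=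
  Quotient.mk d.famSetoid ⟨{({x} : Set X)}, d.isCauchyFamily_singleton x⟩

/-- A regular family (Richman), presented as a function from positive rationals
(the value at `0` being irrelevant): `d(x,y) ≤ p + q` for `x ∈ S p`, `y ∈ S q`. -/
def IsRegularFamily (S : ℚ≥0 → Set X) : Prop :=
  ∀ p q : ℚ≥0, 0 < p → 0 < q → ∀ x ∈ S p, ∀ y ∈ S q, d.le x y (p + q)

/-- The type of regular families on `X`. -/
def RegularFam := {S : ℚ≥0 → Set X // d.IsRegularFamily S}

/-- Richman's equivalence of regular families. -/
def regEquiv (S T : d.RegularFam) : Prop :=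
  ∀ p q : ℚ≥0, 0 < p → 0 < q → ∀ x ∈ S.1 p, ∀ y ∈ T.1 q, d.le x y (p + q)

/-- Richman's completion `X̂_R`: the quotient of the regular families by equivalence. -/
def RHat := Quot d.regEquiv

/-- Richman's premetric between regular families:
`d̂_R(S,T) ≤ q` iff for all `ε > 0` there are `a,b,c > 0`, `s ∈ S a`, `t ∈ T b`
with `a+b+c < q+ε` and `d(s,t) ≤ c`. -/
def regLE (S T : ℚ≥0 → Set X) (q : ℚ≥0) : Prop :=
  ∀ ε : ℚ≥0, 0 < ε → ∃ a b c : ℚ≥0, 0 < a ∧ 0 < b ∧ 0 < c ∧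
    ∃ s ∈ S a, ∃ t ∈ T b, a + b + c < q + ε ∧ d.le s t c

/-- Richman's premetric `d̂_R` on the quotient `X̂_R`. -/
def rHatLE (α β : d.RHat) (q : ℚ≥0) : Prop :=
  ∃ S T : d.RegularFam, Quot.mk d.regEquiv S = α ∧ Quot.mk d.regEquiv T = β ∧
    d.regLE S.1 T.1 q

theorem isRegularFamily_const (x : X) :
    d.IsRegularFamily (fun _ => ({x} : Set X)) := by
  intro p q hp hq y hy z hz
  rw [Set.mem_singleton_iff] at hy hz
  rw [hy, hz]
  exact d.mono (d.refl x) zero_le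

/-- The natural map `i_R : X → X̂_R`, sending `x` to the class of the constant
regular family `S_q = {x}`. -/
def regNatMap (x : X) : d.RHat :=
  Quot.mk d.regEquiv ⟨fun _ => ({x} : Set X), d.isRegularFamily_const x⟩

end Premetric

/-- `f : X → Y` is an isometric embedding of premetric spaces. -/
def IsIsometricEmbedding {X Y : Type*} (dX : Premetric X) (dY : Premetric Y)
    (f : X → Y) : Prop :=
  ∀ (x x' : X) (q : ℚ≥0), dX.le x x' q ↔ dY.le (f x) (f x') q

/-- `f : X → Y` has dense image in the premetric space `Y`. -/
def HasDenseImage {X Y : Type*} (dY : Premetric Y) (f : X → Y) : Prop :=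
  ∀ ε : ℚ≥0, 0 < ε → ∀ y : Y, ∃ x : X, dY.le (f x) y ε

/-- The family `S^c = {S_q^c : q ∈ ℚ⁺}` with
`S_q^c = {f(x) : x ∈ A, d_C(h(x),c) ≤ q/2}`, used in the extension theorem. -/
def extFam {A B C : Type*} (dC : Premetric C) (f : A → B) (h : A → C) (c : C) :
    Set (Set B) :=
  {T | ∃ q : ℚ≥0, 0 < q ∧ T = {b | ∃ x : A, b = f x ∧ dC.le (h x) c (q / 2)}}

/-- For Cauchy families `F`, `G`, `H` on a premetric space `(X,d)`
and nonnegative rationals `p`, `q`: if `d(F,G) ≤ p` and `d(G,H) ≤ q` then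
`d(F,H) ≤ p + q`. -/
theorem statement5 (X : Type*) [Nonempty X] (d : Premetric X)
    (F G H : Set (Set X)) (hF : d.IsCauchyFamily F) (hG : d.IsCauchyFamily G)
    (hH : d.IsCauchyFamily H) (p q : ℚ≥0)
    (h1 : d.famLE F G p) (h2 : d.famLE G H q) : d.famLE F H (p + q) := by
  exact d.famLE_triangle hG h1 h2
end

section
/- Let (A,d_A), (B,d_B), (C,d_C) be premetric spaces, f : A → B an isometric embedding, and h : A → C an isometric embedding with dense image. If g, g' : C → B̂ are isometric embeddings with g ∘ h = i ∘ f and g' ∘ h = i ∘ f, where i : B → B̂ is the natural map, then g = g'. -/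
/-- Isometric embeddings that agree on a dense image are equal. -/
theorem IsIsometricEmbedding.eq_of_comp_eq {A X Y : Type*} {dX : Premetric X}
    {dY : Premetric Y} {h : A → X} (hdense : HasDenseImage dX h) {g g' : X → Y}
    (hg : IsIsometricEmbedding dX dY g) (hg' : IsIsometricEmbedding dX dY g')
    (hcomp : g ∘ h = g' ∘ h) : g = g' := by
  funext c
  refine (dY.refl_iff _ _).1 ((dY.upper _ _ _).2 fun q hq => ?_)
  obtain ⟨x, hx⟩ := hdense (q / 2) (half_pos hq) c
  have hgx : dY.le (g c) (g (h x)) (q / 2) := dY.symm _ _ _ ((hg _ _ _).1 hx)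
  have hgx' : dY.le (g (h x)) (g' c) (q / 2) := by
    rw [show g (h x) = g' (h x) from congrFun hcomp x]
    exact (hg' _ _ _).1 hx
  simpa only [add_halves] using dY.triangle _ _ _ _ _ hgx hgx'

/-- Uniqueness in the extension theorem. With `f : A → B` an
isometric embedding and `h : A → C` an isometric embedding with dense image, any
two isometric embeddings `g, g' : C → B̂` satisfying `g ∘ h = i ∘ f` and
`g' ∘ h = i ∘ f` are equal. -/
theorem statement11 {A B C : Type*} [Nonempty A] [Nonempty B] [Nonempty C]
    (dA : Premetric A) (dB : Premetric B) (dC : Premetric C)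
    (f : A → B) (hf : IsIsometricEmbedding dA dB f)
    (h : A → C) (hh : IsIsometricEmbedding dA dC h)
    (hdense : HasDenseImage dC h)
    (g g' : C → dB.Hat)
    (hg : IsIsometricEmbedding dC dB.hatPremetric g)
    (hg' : IsIsometricEmbedding dC dB.hatPremetric g')
    (hcomm : g ∘ h = dB.natMap ∘ f)
    (hcomm' : g' ∘ h = dB.natMap ∘ f) :
    g = g' := by
  exact hg.eq_of_comp_eq hdense hg' (hcomm.trans hcomm'.symm)
end

section
/- Let (A,d_A), (B,d_B), (C,d_C) be premetric spaces, f : A → B an isometric embedding, and h : A → C an isometric embedding with dense image. For each c ∈ C and positive rational q let S_q^c = {f(x) : x ∈ A, d_C(h(x),c) ≤ q/2}, and let S^c = {S_q^c : q ∈ ℚ⁺}. Then the map g : C → B̂ defined by g(c) = [S^c] is an isometric embedding: for all c,c' ∈ C and nonnegative rationals p, d_C(c,c') ≤ p if and only if d̂_B([S^c],[S^{c'}]) ≤ p. -/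
theorem Premetric.le_of_forall_pos_add {X : Type*} (d : Premetric X) {x y : X} {p : ℚ≥0}
    (H : ∀ ε : ℚ≥0, 0 < ε → d.le x y (p + ε)) : d.le x y p := by
  refine (d.upper x y p).2 fun q hpq => ?_
  obtain ⟨ε, hε, rfl⟩ := exists_pos_add_of_lt' hpq
  exact H ε hε

section extFam

variable {A B C : Type*} {dB : Premetric B} {dC : Premetric C} {f : A → B} {h : A → C}

theorem famLE_extFam_of_le (hfh : ∀ x y q, dB.le (f x) (f y) q ↔ dC.le (h x) (h y) q)
    {c c' : C} {p : ℚ≥0} (hp : dC.le c c' p) :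
    dB.famLE (extFam dC f h c) (extFam dC f h c') p := by
  have dist_le : ∀ {u v : C} {r ε : ℚ≥0} {x y : A}, dC.le u v r →
      dC.le (h x) u (ε / 2) → dC.le (h y) v (ε / 2) → dB.le (f x) (f y) (r + ε) := by
    intro u v r ε x y huv hx hy
    have key := dC.triangle _ _ _ _ _ hx
      (dC.triangle _ _ _ _ _ huv (dC.symm _ _ _ hy))
    rw [add_left_comm, add_halves] at key
    exact (hfh x y _).2 key
  have diam_le : ∀ (u : C) (ε : ℚ≥0),
      dB.diamLE {b | ∃ x : A, b = f x ∧ dC.le (h x) u (ε / 2)} ε := by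
    rintro u ε _ ⟨x, rfl, hx⟩ _ ⟨y, rfl, hy⟩
    simpa using dist_le (dC.refl u) hx hy
  intro ε hε
  refine ⟨_, ⟨ε, hε, rfl⟩, _, ⟨ε, hε, rfl⟩, diam_le c ε, diam_le c' ε, ?_⟩
  rintro b (hb | hb) b' (hb' | hb')
  · exact dB.mono (diam_le c ε b hb b' hb') le_add_self
  · obtain ⟨x, rfl, hx⟩ := hb
    obtain ⟨y, rfl, hy⟩ := hb'
    exact dist_le hp hx hy
  · obtain ⟨x, rfl, hx⟩ := hb
    obtain ⟨y, rfl, hy⟩ := hb'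
    exact dist_le (dC.symm _ _ _ hp) hx hy
  · exact dB.mono (diam_le c' ε b hb b' hb') le_add_self

theorem le_of_famLE_extFam (hfh : ∀ x y q, dB.le (f x) (f y) q ↔ dC.le (h x) (h y) q)
    (hdense : HasDenseImage dC h) {c c' : C} {p : ℚ≥0}
    (hp : dB.famLE (extFam dC f h c) (extFam dC f h c') p) : dC.le c c' p := by
  refine dC.le_of_forall_pos_add fun ε hε => ?_
  have hε3 : 0 < ε / 3 := by positivity
  obtain ⟨_, ⟨a, ha, rfl⟩, _, ⟨b, hb, rfl⟩, -, -, hdiam⟩ := hp (ε / 3) hε3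
  obtain ⟨x, hx⟩ := hdense (min (a / 2) (ε / 3)) (lt_min (by positivity) hε3) c
  obtain ⟨y, hy⟩ := hdense (min (b / 2) (ε / 3)) (lt_min (by positivity) hε3) c'
  have hxy : dC.le (h x) (h y) (p + ε / 3) := (hfh x y _).1 <|
    hdiam _ (Or.inl ⟨x, rfl, dC.mono hx (min_le_left _ _)⟩)
      _ (Or.inr ⟨y, rfl, dC.mono hy (min_le_left _ _)⟩)
  have key := dC.triangle _ _ _ _ _
    (dC.symm _ _ _ (dC.mono hx (min_le_right _ _)))
    (dC.triangle _ _ _ _ _ hxy (dC.mono hy (min_le_right _ _)))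
  have hsum : ε / 3 + (p + ε / 3 + ε / 3) = p + ε := by ring
  rwa [hsum] at key

end extFam

/-- With `f : A → B` an isometric embedding and `h : A → C` an
isometric embedding with dense image, the map `g : C → B̂`, `g(c) = [S^c]`, is an
isometric embedding: `d_C(c,c') ≤ p` iff `d̂_B([S^c],[S^{c'}]) ≤ p`. -/
theorem statement13 {A B C : Type*} [Nonempty A] [Nonempty B] [Nonempty C]
    (dA : Premetric A) (dB : Premetric B) (dC : Premetric C)
    (f : A → B) (hf : IsIsometricEmbedding dA dB f)
    (h : A → C) (hh : IsIsometricEmbedding dA dC h)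
    (hdense : HasDenseImage dC h)
    (hCau : ∀ c : C, dB.IsCauchyFamily (extFam dC f h c)) :
    IsIsometricEmbedding dC dB.hatPremetric
      (fun c => Quotient.mk dB.famSetoid ⟨extFam dC f h c, hCau c⟩) := by
  have hfh : ∀ x y q, dB.le (f x) (f y) q ↔ dC.le (h x) (h y) q :=
    fun x y q => (hf x y q).symm.trans (hh x y q)
  exact fun c c' p => ⟨famLE_extFam_of_le hfh, le_of_famLE_extFam hfh hdense⟩
end
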